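/- arXiv:math/9903120 — 5 statements merged into one kernel-verified Lean document; each statement's English description precedes it below -/
import Mathlib

section
/- Let K be an algebraically closed field, let α, β, γ ∈ K with β ≠ 0, and let A = A(α,β,γ) be the down-up algebra. Then the powers of d form a left and right Ore set in A, and likewise for the powers of u. Concretely: for every a ∈ A and every n ∈ ℕ there exist b ∈ A and m ∈ ℕ with d^m · a = b · d^n, and there exist c ∈ A and k ∈ ℕ with a · d^k = d^n · c; the same two conditions hold with d replaced by u throughout. -/
noncomputable section

/-- The defining relations of the down-up algebra `A(α,β,γ)`:
generator `0` is `d`, generator `1` is `u`. -/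
inductive DownUpRel (K : Type) [Field K] (α β γ : K) :
    FreeAlgebra K (Fin 2) → FreeAlgebra K (Fin 2) → Prop
  | rel1 : DownUpRel K α β γ
      (FreeAlgebra.ι K 0 * FreeAlgebra.ι K 0 * FreeAlgebra.ι K 1)
      (α • (FreeAlgebra.ι K 0 * FreeAlgebra.ι K 1 * FreeAlgebra.ι K 0) +
        β • (FreeAlgebra.ι K 1 * FreeAlgebra.ι K 0 * FreeAlgebra.ι K 0) +
        γ • FreeAlgebra.ι K 0)
  | rel2 : DownUpRel K α β γ
      (FreeAlgebra.ι K 0 * FreeAlgebra.ι K 1 * FreeAlgebra.ι K 1)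
      (α • (FreeAlgebra.ι K 1 * FreeAlgebra.ι K 0 * FreeAlgebra.ι K 1) +
        β • (FreeAlgebra.ι K 1 * FreeAlgebra.ι K 1 * FreeAlgebra.ι K 0) +
        γ • FreeAlgebra.ι K 1)

/-- The down-up algebra `A(α,β,γ)`. -/
abbrev DownUp (K : Type) [Field K] (α β γ : K) := RingQuot (DownUpRel K α β γ)

/-- The generator `d` of the down-up algebra. -/
def DownUp.d (K : Type) [Field K] (α β γ : K) : DownUp K α β γ :=
  RingQuot.mkAlgHom K (DownUpRel K α β γ) (FreeAlgebra.ι K 0)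

/-- The generator `u` of the down-up algebra. -/
def DownUp.u (K : Type) [Field K] (α β γ : K) : DownUp K α β γ :=
  RingQuot.mkAlgHom K (DownUpRel K α β γ) (FreeAlgebra.ι K 1)


section Ore

variable {K R : Type*} [Field K] [Ring R] [Algebra K R]

/-- The elements `a` satisfying the left Ore condition with respect to all powers of `s`. -/
def leftOreSubalgebra (K : Type*) {R : Type*} [Field K] [Ring R] [Algebra K R] (s : R) :
    Subalgebra K R where
  carrier := {a | ∀ n : ℕ, ∃ (b : R) (m : ℕ), s ^ m * a = b * s ^ n}
  mul_mem' {a a'} ha ha' n := by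
    obtain ⟨b, m, h⟩ := ha' n
    obtain ⟨b', m', h'⟩ := ha m
    exact ⟨b' * b, m', by rw [← mul_assoc, h', mul_assoc, h, mul_assoc]⟩
  add_mem' {a a'} ha ha' n := by
    obtain ⟨b, m, h⟩ := ha n
    obtain ⟨b', m', h'⟩ := ha' n
    refine ⟨s ^ m' * b + s ^ m * b', m' + m, ?_⟩
    rw [mul_add, add_mul, mul_assoc, mul_assoc, ← h, ← h', ← mul_assoc, ← mul_assoc,
      ← pow_add, ← pow_add, add_comm m m']
  algebraMap_mem' r n := ⟨algebraMap K R r, n, (Algebra.commutes r (s ^ n)).symm⟩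

theorem exists_pow_succ_mul_eq {x y : R} {a b c : K}
    (h : x * x * y = (a • (x * y) + b • (y * x) + c • 1) * x) (n : ℕ) :
    ∃ p q r : K, x ^ (n + 1) * y = (p • (x * y) + q • (y * x) + r • 1) * x ^ n := by
  induction n with
  | zero => exact ⟨1, 0, 0, by simp⟩
  | succ n ih =>
    obtain ⟨p, q, r, ih⟩ := ih
    refine ⟨p * a + q, p * b, p * c + r, ?_⟩
    have key : x * (p • (x * y) + q • (y * x) + r • 1) =
        ((p * a + q) • (x * y) + (p * b) • (y * x) + (p * c + r) • 1) * x := by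
      rw [mul_add, mul_add, mul_smul_comm, ← mul_assoc, h]
      simp only [add_mul, smul_mul_assoc, mul_smul_comm, smul_add, add_smul, mul_smul, mul_assoc,
        mul_one, one_mul]
      abel
    rw [pow_succ' x (n + 1), mul_assoc, ih, ← mul_assoc, key, mul_assoc, ← pow_succ']

theorem left_ore_of_adjoin_eq_top {x y : R} {a b c : K}
    (h : x * x * y = (a • (x * y) + b • (y * x) + c • 1) * x)
    (htop : Algebra.adjoin K {x, y} = ⊤) (z : R) (n : ℕ) :
    ∃ (w : R) (m : ℕ), x ^ m * z = w * x ^ n := by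
  have hle : Algebra.adjoin K {x, y} ≤ leftOreSubalgebra K x := by
    rw [Algebra.adjoin_le_iff]
    rintro _ (rfl | rfl) n
    · exact ⟨_, n, (pow_mul_comm' _ n)⟩
    · obtain ⟨p, q, r, hn⟩ := exists_pow_succ_mul_eq h n
      exact ⟨_, n + 1, hn⟩
  exact (htop ▸ hle) (Algebra.mem_top : z ∈ ⊤) n

open MulOpposite in
theorem right_ore_of_adjoin_eq_top {x y : R} {a b c : K}
    (h : y * x * x = x * (a • (x * y) + b • (y * x) + c • 1))
    (htop : Algebra.adjoin K {x, y} = ⊤) (z : R) (n : ℕ) :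
    ∃ (w : R) (m : ℕ), z * x ^ m = x ^ n * w := by
  have h' : op x * op x * op y =
      (b • (op x * op y) + a • (op y * op x) + c • 1) * op x := by
    apply unop_injective
    simpa [mul_assoc, add_comm, add_left_comm] using h
  have htop' : Algebra.adjoin K {op x, op y} = ⊤ := by
    have := congrArg Subalgebra.op htop
    rw [Subalgebra.op_adjoin, Subalgebra.op_top] at this
    rw [← this]
    congr 1
    ext w
    simp [← unop_inj]
  obtain ⟨w, m, hw⟩ := left_ore_of_adjoin_eq_top h' htop' (op z) n
  exact ⟨unop w, m, op_injective (by simpa using hw)⟩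

end Ore

namespace DownUp

variable (K : Type) [Field K] (α β γ : K)

theorem adjoin_d_u : Algebra.adjoin K {d K α β γ, u K α β γ} = ⊤ := by
  have h := congrArg (Subalgebra.map (RingQuot.mkAlgHom K (DownUpRel K α β γ)))
    (FreeAlgebra.adjoin_range_ι K (Fin 2))
  rw [AlgHom.map_adjoin, Algebra.map_top,
    (AlgHom.range_eq_top _).2 (RingQuot.mkAlgHom_surjective K _), ← Set.range_comp] at h
  rw [← h]
  congr 1
  ext w
  simp [Fin.exists_fin_two, d, u, eq_comm]

theorem d_mul_d_mul_u : d K α β γ * d K α β γ * u K α β γ =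
    α • (d K α β γ * u K α β γ * d K α β γ) + β • (u K α β γ * d K α β γ * d K α β γ) +
      γ • d K α β γ := by
  simpa [d, u] using RingQuot.mkAlgHom_rel K (DownUpRel.rel1 (K := K) (α := α) (β := β) (γ := γ))

theorem d_mul_u_mul_u : d K α β γ * u K α β γ * u K α β γ =
    α • (u K α β γ * d K α β γ * u K α β γ) + β • (u K α β γ * u K α β γ * d K α β γ) +
      γ • u K α β γ := by
  simpa [d, u] using RingQuot.mkAlgHom_rel K (DownUpRel.rel2 (K := K) (α := α) (β := β) (γ := γ))

end DownUp

/-- for `β ≠ 0`, the powers of `d` (resp. of `u`) form a left and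
right Ore set in the down-up algebra `A(α,β,γ)`. -/
theorem downUp_powers_d_u_ore (K : Type) [Field K] [IsAlgClosed K]
    (α β γ : K) (hβ : β ≠ 0) (a : DownUp K α β γ) (n : ℕ) :
    (∃ (b : DownUp K α β γ) (m : ℕ),
        (DownUp.d K α β γ) ^ m * a = b * (DownUp.d K α β γ) ^ n) ∧
    (∃ (c : DownUp K α β γ) (k : ℕ),
        a * (DownUp.d K α β γ) ^ k = (DownUp.d K α β γ) ^ n * c) ∧
    (∃ (b : DownUp K α β γ) (m : ℕ),
        (DownUp.u K α β γ) ^ m * a = b * (DownUp.u K α β γ) ^ n) ∧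
    (∃ (c : DownUp K α β γ) (k : ℕ),
        a * (DownUp.u K α β γ) ^ k = (DownUp.u K α β γ) ^ n * c) := by
  have htop := DownUp.adjoin_d_u K α β γ
  have htop' := htop
  rw [Set.pair_comm] at htop'
  have h₁ := DownUp.d_mul_d_mul_u K α β γ
  have h₂ := DownUp.d_mul_u_mul_u K α β γ
  refine ⟨left_ore_of_adjoin_eq_top (a := α) (b := β) (c := γ) ?_ htop a n,
    right_ore_of_adjoin_eq_top (a := β⁻¹) (b := -(β⁻¹ * α)) (c := -(β⁻¹ * γ)) ?_ htop a n,
    left_ore_of_adjoin_eq_top (a := -(β⁻¹ * α)) (b := β⁻¹) (c := -(β⁻¹ * γ)) ?_ htop' a n,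
    right_ore_of_adjoin_eq_top (a := β) (b := α) (c := γ) ?_ htop' a n⟩
  · simpa [add_mul] using h₁
  · simp only [mul_add, mul_smul_comm, mul_one, ← mul_assoc]
    rw [h₁, smul_add, smul_add, smul_smul, smul_smul, smul_smul, inv_mul_cancel₀ hβ]
    module
  · simp only [add_mul, smul_mul_assoc, one_mul]
    rw [h₂, smul_add, smul_add, smul_smul, smul_smul, smul_smul, inv_mul_cancel₀ hβ]
    module
  · rw [h₂]
    simp only [mul_add, mul_smul_comm, mul_one, ← mul_assoc]
    module
end
end

section
/- Let K be an algebraically closed field, let α, β, γ ∈ K with β ≠ 0, and let A = A(α,β,γ) be the down-up algebra. Let M be a finite-dimensional simple left A-module on which the action of d is not injective. Then M is a highest weight module: there exist a nonzero v ∈ M and λ ∈ K with d·v = 0, (d·u)·v = λ·v, and M = A·v. -/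
noncomputable section

theorem DownUp.d_mul_d_mul_u_s3 (K : Type) [Field K] (α β γ : K) :
    d K α β γ * (d K α β γ * u K α β γ) =
      α • (d K α β γ * u K α β γ * d K α β γ) +
        β • (u K α β γ * d K α β γ * d K α β γ) + γ • d K α β γ := by
  simpa [d, u, mul_assoc] using
    RingQuot.mkAlgHom_rel K (DownUpRel.rel1 (K := K) (α := α) (β := β) (γ := γ))

/-- The kernel of `d` is stable under the action of `d * u`. -/
theorem DownUp.d_smul_d_mul_u_smul_eq_zero {K : Type} [Field K] {α β γ : K}
    {M : Type*} [AddCommGroup M] [Module K M] [Module (DownUp K α β γ) M]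
    [IsScalarTower K (DownUp K α β γ) M] {m : M} (hm : d K α β γ • m = 0) :
    d K α β γ • (d K α β γ * u K α β γ) • m = 0 := by
  rw [← mul_smul, d_mul_d_mul_u_s3]
  simp only [add_smul, smul_assoc, mul_smul, hm, smul_zero, add_zero]

/-- every finite-dimensional simple left module over a Noetherian
down-up algebra on which `d` does not act injectively is a highest weight
module. -/
theorem downUp_fd_simple_d_torsion_highest_weight (K : Type) [Field K] [IsAlgClosed K]
    (α β γ : K) (hβ : β ≠ 0)
    (M : Type) [AddCommGroup M] [Module K M] [Module (DownUp K α β γ) M]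
    [IsScalarTower K (DownUp K α β γ) M]
    [FiniteDimensional K M] [IsSimpleModule (DownUp K α β γ) M]
    (hd : ¬ Function.Injective (fun m : M => DownUp.d K α β γ • m)) :
    ∃ (v : M) (l : K), v ≠ 0 ∧ DownUp.d K α β γ • v = 0 ∧
      (DownUp.d K α β γ * DownUp.u K α β γ) • v = l • v ∧
      ∀ m : M, ∃ a : DownUp K α β γ, m = a • v := by
  let D : Module.End K M := Algebra.lsmul K K M (DownUp.d K α β γ)
  let T : Module.End K M := Algebra.lsmul K K M (DownUp.d K α β γ * DownUp.u K α β γ)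
  have hT : ∀ m ∈ LinearMap.ker D, T m ∈ LinearMap.ker D := fun m hm =>
    DownUp.d_smul_d_mul_u_smul_eq_zero (M := M) hm
  have hker : LinearMap.ker D ≠ ⊥ := fun h => hd (LinearMap.ker_eq_bot.mp h)
  have : Nontrivial (LinearMap.ker D) := Submodule.nontrivial_iff_ne_bot.mpr hker
  obtain ⟨l, hl⟩ := Module.End.exists_eigenvalue (T.restrict hT)
  obtain ⟨v, hv⟩ := hl.exists_hasEigenvector
  have hv0 : (v : M) ≠ 0 := fun h => hv.2 (Subtype.ext h)
  refine ⟨v, l, hv0, v.2, congrArg Subtype.val hv.apply_eq_smul, fun m => ?_⟩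
  obtain ⟨a, ha⟩ := IsSimpleModule.toSpanSingleton_surjective (DownUp K α β γ) hv0 m
  exact ⟨a, ha.symm⟩
end
end

section
/- Let K be an algebraically closed field of characteristic 0, let η ∈ K with η ≠ 0 and η ≠ 1, let γ ∈ K with γ ≠ 0, and set α = 1+η, β = −η. Let λ ∈ K and let (λ_n) be the associated sequence. Then for every n ≥ 1: (i) if λ_{n−1} = 0 then η^n ≠ 1; and (ii) if η^n ≠ 1, then λ_{n−1} = 0 if and only if λ·(η − 1) = −γ·(1 − n·(Σ_{i=0}^{n−1} η^i)^{-1}) (note that Σ_{i=0}^{n−1} η^i ≠ 0 when η^n ≠ 1 and η ≠ 1). -/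
noncomputable section

/-- The sequence `λ_{-1} = 0`, `λ_0 = λ`, `λ_n = α·λ_{n-1} + β·λ_{n-2} + γ`,
shifted so that `lamSeq α β γ l n = λ_{n-1}` (thus `lamSeq α β γ l 0 = 0` and
`lamSeq α β γ l 1 = l`). -/
def lamSeq {K : Type} [Field K] (α β γ l : K) : ℕ → K
  | 0 => 0
  | 1 => l
  | (n + 2) => α * lamSeq α β γ l (n + 1) + β * lamSeq α β γ l n + γ


theorem lamSeq_succ {K : Type} [Field K] (η γ l : K) (n : ℕ) :
    lamSeq (1 + η) (-η) γ l (n + 1) = η * lamSeq (1 + η) (-η) γ l n + l + n * γ := by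
  induction n with
  | zero => simp [lamSeq]
  | succ n ih =>
    rw [lamSeq]
    push_cast
    linear_combination ih

theorem sub_one_mul_lamSeq {K : Type} [Field K] (η γ l : K) (n : ℕ) :
    (η - 1) * lamSeq (1 + η) (-η) γ l n =
      (∑ i ∈ Finset.range n, η ^ i) * (l * (η - 1) + γ) - n * γ := by
  induction n with
  | zero => simp [lamSeq]
  | succ n ih =>
    rw [lamSeq_succ, geom_sum_succ]
    push_cast
    linear_combination η * ih

/-- for `A_η` (i.e. `α = 1+η`, `β = −η`, `γ ≠ 0`) with `η ≠ 0,1`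
in characteristic `0`:
(i) if `λ_{n-1} = 0` then `η^n ≠ 1`; and
(ii) if `η^n ≠ 1` then `λ_{n-1} = 0` iff
`λ·(η−1) = −γ·(1 − n·(Σ_{i<n} η^i)⁻¹)`.
(Recall `lamSeq α β γ l n = λ_{n-1}`.) -/
theorem downUp_eta_lambda_vanishing (K : Type) [Field K] [IsAlgClosed K] [CharZero K]
    (η γ : K) (hη0 : η ≠ 0) (hη1 : η ≠ 1) (hγ : γ ≠ 0) (l : K) (n : ℕ) (hn : 1 ≤ n) :
    (lamSeq (1 + η) (-η) γ l n = 0 → η ^ n ≠ 1) ∧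
    (η ^ n ≠ 1 →
      (lamSeq (1 + η) (-η) γ l n = 0 ↔
        l * (η - 1) = -γ * (1 - (n : K) * (∑ i ∈ Finset.range n, η ^ i)⁻¹))) := by
  have hη : η - 1 ≠ 0 := sub_ne_zero.mpr hη1
  have hs := sub_one_mul_lamSeq η γ l n
  have hg : (∑ i ∈ Finset.range n, η ^ i) * (η - 1) = η ^ n - 1 := geom_sum_mul η n
  constructor
  · intro h hp
    have hS : ∑ i ∈ Finset.range n, η ^ i = 0 := by simpa [hp, hη] using hg
    have hn' : (n : K) ≠ 0 := Nat.cast_ne_zero.mpr (by lia)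
    simp [h, hS, hn', hγ] at hs
  · intro hp
    have hS : ∑ i ∈ Finset.range n, η ^ i ≠ 0 := by
      intro h
      rw [h, zero_mul] at hg
      exact hp (sub_eq_zero.mp hg.symm)
    rw [← mul_eq_zero_iff_left hη, hs]
    have hinv := mul_inv_cancel₀ hS
    constructor <;> intro h
    · refine mul_left_cancel₀ hS ?_
      linear_combination h - n * γ * hinv
    · linear_combination (∑ i ∈ Finset.range n, η ^ i) * h + n * γ * hinv
end
end

section
/- Let K be an algebraically closed field, α, β, γ ∈ K, and let A = A(α,β,γ) be the down-up algebra. Let B be the quotient of A by the two-sided ideal generated by d·u − u·d (the largest commutative homomorphic image of A). Then B is isomorphic as a K-algebra to the quotient of the commutative polynomial ring K[a,b] by the ideal generated by a·(a·b·(1−α−β) − γ) and b·(a·b·(1−α−β) − γ). In particular, if γ = 0 and α + β = 1, then B is isomorphic to the polynomial ring K[a,b]. -/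
noncomputable section

/-- The largest commutative homomorphic image `B` of the down-up algebra:
the quotient of `A(α,β,γ)` by the (congruence generated by the) relation
`d·u = u·d`, i.e. by the two-sided ideal generated by `d·u − u·d`. -/
abbrev DownUpAb (K : Type) [Field K] (α β γ : K) :=
  RingQuot (fun a b : DownUp K α β γ =>
    a = DownUp.d K α β γ * DownUp.u K α β γ ∧ b = DownUp.u K α β γ * DownUp.d K α β γ)

namespace DownUpAb

variable (K : Type) [Field K] (α β γ : K)

/-- The image of the generator `d` in the commutative quotient. -/
def d : DownUpAb K α β γ := RingQuot.mkAlgHom K _ (DownUp.d K α β γ)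

/-- The image of the generator `u` in the commutative quotient. -/
def u : DownUpAb K α β γ := RingQuot.mkAlgHom K _ (DownUp.u K α β γ)

/-- The projection from the free algebra onto the commutative quotient. -/
def ofFree : FreeAlgebra K (Fin 2) →ₐ[K] DownUpAb K α β γ :=
  (RingQuot.mkAlgHom K _).comp (RingQuot.mkAlgHom K (DownUpRel K α β γ))

theorem ofFree_surjective : Function.Surjective (ofFree K α β γ) :=
  (RingQuot.mkAlgHom_surjective K _).comp (RingQuot.mkAlgHom_surjective K _)

@[simp] theorem ofFree_ι_zero : ofFree K α β γ (FreeAlgebra.ι K 0) = d K α β γ := rfl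

@[simp] theorem ofFree_ι_one : ofFree K α β γ (FreeAlgebra.ι K 1) = u K α β γ := rfl

theorem ofFree_eq_of_rel {x y : FreeAlgebra K (Fin 2)} (h : DownUpRel K α β γ x y) :
    ofFree K α β γ x = ofFree K α β γ y :=
  congrArg (RingQuot.mkAlgHom K _) (RingQuot.mkAlgHom_rel K h)

theorem d_mul_u : d K α β γ * u K α β γ = u K α β γ * d K α β γ := by
  have h := RingQuot.mkAlgHom_rel K
    (s := fun a b : DownUp K α β γ =>
      a = DownUp.d K α β γ * DownUp.u K α β γ ∧ b = DownUp.u K α β γ * DownUp.d K α β γ)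
    ⟨rfl, rfl⟩
  rwa [map_mul, map_mul] at h

variable {K α β γ} in
/-- An element commuting with both generators is central. -/
theorem commute_of_commute_generators {z : DownUpAb K α β γ} (hd : Commute z (d K α β γ))
    (hu : Commute z (u K α β γ)) (x : DownUpAb K α β γ) : Commute z x := by
  obtain ⟨x, rfl⟩ := ofFree_surjective K α β γ x
  induction x using FreeAlgebra.induction with
  | grade0 r => rw [AlgHom.commutes]; exact (Algebra.commutes r z).symm
  | grade1 i => fin_cases i <;> assumption
  | mul a b ha hb => simpa using ha.mul_right hb
  | add a b ha hb => simpa using ha.add_right hb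

instance : CommRing (DownUpAb K α β γ) where
  mul_comm x y :=
    commute_of_commute_generators
      (commute_of_commute_generators (Commute.refl _) (d_mul_u K α β γ) x).symm
      (commute_of_commute_generators (d_mul_u K α β γ).symm (Commute.refl _) x).symm y

variable {K α β γ} in
theorem algHom_ext {S : Type*} [Semiring S] [Algebra K S] {f g : DownUpAb K α β γ →ₐ[K] S}
    (hd : f (d K α β γ) = g (d K α β γ)) (hu : f (u K α β γ) = g (u K α β γ)) : f = g := by
  have h : f.comp (ofFree K α β γ) = g.comp (ofFree K α β γ) := by
    ext i
    fin_cases i <;> assumption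
  exact AlgHom.cancel_right (ofFree_surjective K α β γ) |>.mp h

/-- The first defining relation of the down-up algebra, in commutative form. -/
theorem d_mul_relation :
    d K α β γ * (d K α β γ * u K α β γ *
      (1 - algebraMap K _ α - algebraMap K _ β) - algebraMap K _ γ) = 0 := by
  have h := ofFree_eq_of_rel K α β γ DownUpRel.rel1
  simp only [map_mul, map_add, map_smul, ofFree_ι_zero, ofFree_ι_one] at h
  simp only [Algebra.smul_def] at h
  linear_combination h

/-- The second defining relation of the down-up algebra, in commutative form. -/
theorem u_mul_relation :
    u K α β γ * (d K α β γ * u K α β γ *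
      (1 - algebraMap K _ α - algebraMap K _ β) - algebraMap K _ γ) = 0 := by
  have h := ofFree_eq_of_rel K α β γ DownUpRel.rel2
  simp only [map_mul, map_add, map_smul, ofFree_ι_zero, ofFree_ι_one] at h
  simp only [Algebra.smul_def] at h
  linear_combination h

section lift

variable {K α β γ} {S : Type*} [CommRing S] [Algebra K S] {x y : S}
  (hx : x * (x * y * (1 - algebraMap K S α - algebraMap K S β) - algebraMap K S γ) = 0)
  (hy : y * (x * y * (1 - algebraMap K S α - algebraMap K S β) - algebraMap K S γ) = 0)

/-- The algebra map out of the down-up algebra determined by a pair of elements of a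
commutative algebra which satisfies the relations. -/
def liftDownUp : DownUp K α β γ →ₐ[K] S :=
  RingQuot.liftAlgHom K ⟨FreeAlgebra.lift K ![x, y], by
    rintro _ _ (_ | _)
    · simp only [map_mul, map_add, map_smul, FreeAlgebra.lift_ι_apply,
        Matrix.cons_val_zero, Matrix.cons_val_one]
      simp only [Algebra.smul_def]
      linear_combination hx
    · simp only [map_mul, map_add, map_smul, FreeAlgebra.lift_ι_apply,
        Matrix.cons_val_zero, Matrix.cons_val_one]
      simp only [Algebra.smul_def]
      linear_combination hy⟩

@[simp] theorem liftDownUp_d : liftDownUp hx hy (DownUp.d K α β γ) = x := by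
  rw [liftDownUp, DownUp.d, RingQuot.liftAlgHom_mkAlgHom_apply, FreeAlgebra.lift_ι_apply]
  rfl

@[simp] theorem liftDownUp_u : liftDownUp hx hy (DownUp.u K α β γ) = y := by
  rw [liftDownUp, DownUp.u, RingQuot.liftAlgHom_mkAlgHom_apply, FreeAlgebra.lift_ι_apply]
  rfl

/-- The factorization of `liftDownUp` through the commutative quotient. -/
def lift : DownUpAb K α β γ →ₐ[K] S :=
  RingQuot.liftAlgHom K ⟨liftDownUp hx hy, by
    rintro _ _ ⟨rfl, rfl⟩
    rw [map_mul, map_mul, mul_comm]⟩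

@[simp] theorem lift_d : lift hx hy (d K α β γ) = x := by
  rw [lift, d, RingQuot.liftAlgHom_mkAlgHom_apply, liftDownUp_d]

@[simp] theorem lift_u : lift hx hy (u K α β γ) = y := by
  rw [lift, u, RingQuot.liftAlgHom_mkAlgHom_apply, liftDownUp_u]

end lift

open MvPolynomial

/-- The ideal of relations of the commutative quotient in the polynomial ring. -/
abbrev relationIdeal : Ideal (MvPolynomial (Fin 2) K) :=
  Ideal.span
    {X 0 * (X 0 * X 1 * (1 - C α - C β) - C γ),
     X 1 * (X 0 * X 1 * (1 - C α - C β) - C γ)}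

/-- The map from the presented commutative algebra to the commutative quotient. -/
def ofQuotient :
    MvPolynomial (Fin 2) K ⧸ relationIdeal K α β γ →ₐ[K] DownUpAb K α β γ :=
  Ideal.Quotient.liftₐ _ (aeval ![d K α β γ, u K α β γ]) (by
    suffices h : relationIdeal K α β γ ≤
        RingHom.ker (aeval (R := K) ![d K α β γ, u K α β γ]) from fun a ha => h ha
    rw [Ideal.span_le]
    rintro _ (rfl | rfl)
    · simpa [RingHom.mem_ker, -mul_eq_zero] using d_mul_relation K α β γ
    · simpa [RingHom.mem_ker, -mul_eq_zero] using u_mul_relation K α β γ)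

@[simp] theorem ofQuotient_mk_X_zero :
    ofQuotient K α β γ (Ideal.Quotient.mk _ (X 0)) = d K α β γ :=
  aeval_X (R := K) ![d K α β γ, u K α β γ] 0

@[simp] theorem ofQuotient_mk_X_one :
    ofQuotient K α β γ (Ideal.Quotient.mk _ (X 1)) = u K α β γ :=
  aeval_X (R := K) ![d K α β γ, u K α β γ] 1

/-- The presentation of the commutative quotient by generators and relations. -/
def equivQuotient :
    DownUpAb K α β γ ≃ₐ[K] MvPolynomial (Fin 2) K ⧸ relationIdeal K α β γ :=
  AlgEquiv.ofAlgHom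
    (lift (x := Ideal.Quotient.mkₐ K (relationIdeal K α β γ) (X 0))
      (y := Ideal.Quotient.mkₐ K (relationIdeal K α β γ) (X 1))
      (by
        have h : Ideal.Quotient.mkₐ K (relationIdeal K α β γ)
            (X 0 * (X 0 * X 1 * (1 - C α - C β) - C γ)) = 0 :=
          Ideal.Quotient.eq_zero_iff_mem.mpr (Ideal.subset_span (by simp))
        simpa only [map_mul, map_sub, map_one, ← algebraMap_eq, AlgHom.commutes] using h)
      (by
        have h : Ideal.Quotient.mkₐ K (relationIdeal K α β γ)
            (X 1 * (X 0 * X 1 * (1 - C α - C β) - C γ)) = 0 :=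
          Ideal.Quotient.eq_zero_iff_mem.mpr (Ideal.subset_span (by simp))
        simpa only [map_mul, map_sub, map_one, ← algebraMap_eq, AlgHom.commutes] using h))
    (ofQuotient K α β γ)
    (by
      apply Ideal.Quotient.algHom_ext
      ext i
      fin_cases i <;> simp)
    (by apply algHom_ext <;> simp)

end DownUpAb

open MvPolynomial in
/-- the largest commutative image `B` of `A(α,β,γ)` is
`K[a,b]/(a·(ab(1−α−β) − γ), b·(ab(1−α−β) − γ))`; in particular if `γ = 0` and
`α + β = 1` then `B ≅ K[a,b]`. -/
theorem downUp_largest_commutative_image (K : Type) [Field K] [IsAlgClosed K]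
    (α β γ : K) :
    Nonempty (DownUpAb K α β γ ≃ₐ[K]
      (MvPolynomial (Fin 2) K ⧸ Ideal.span
        {X 0 * (X 0 * X 1 * (1 - C α - C β) - C γ),
         X 1 * (X 0 * X 1 * (1 - C α - C β) - C γ)})) ∧
    (γ = 0 → α + β = 1 →
      Nonempty (DownUpAb K α β γ ≃ₐ[K] MvPolynomial (Fin 2) K)) := by
  refine ⟨⟨DownUpAb.equivQuotient K α β γ⟩, ?_⟩
  rintro rfl h
  have hI : DownUpAb.relationIdeal K α β 0 = ⊥ := by
    have hC : (1 - C α - C β : MvPolynomial (Fin 2) K) = 0 := by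
      rw [sub_sub, ← C_add, h, C_1, sub_self]
    simp [DownUpAb.relationIdeal, hC]
  exact ⟨(DownUpAb.equivQuotient K α β 0).trans
    ((Ideal.quotientEquivAlgOfEq K hI).trans (AlgEquiv.quotientBot K _))⟩
end
end

section
/- Let K be an algebraically closed field, let α, β, γ ∈ K with β ≠ 0, γ ≠ 0 and α + β ≠ 1 (type (c)), and let A = A(α,β,γ) be the down-up algebra. For μ ∈ K define the two-sided ideal M_μ of A as follows: M_0 is the two-sided ideal generated by d and u, and for μ ≠ 0, M_μ is the kernel of the K-algebra homomorphism Φ_μ : A → K determined by Φ_μ(d) = γ·μ^{-1} and Φ_μ(u) = (1−α−β)^{-1}·μ (this assignment respects the defining relations). Then M_μ² = M_μ if and only if μ = 0. -/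
noncomputable section

/-- The two-sided ideal `M₀ = (d, u)` of the down-up algebra, viewed as a
`K`-submodule. -/
def downUpM0 (K : Type) [Field K] (α β γ : K) : Submodule K (DownUp K α β γ) :=
  Submodule.span K {x : DownUp K α β γ | ∃ a b : DownUp K α β γ,
    x = a * DownUp.d K α β γ * b ∨ x = a * DownUp.u K α β γ * b}

theorem DownUp.d_sq_mul_u (K : Type) [Field K] (α β γ : K) :
    DownUp.d K α β γ * DownUp.d K α β γ * DownUp.u K α β γ =
      α • (DownUp.d K α β γ * DownUp.u K α β γ * DownUp.d K α β γ) +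
        β • (DownUp.u K α β γ * DownUp.d K α β γ * DownUp.d K α β γ) +
        γ • DownUp.d K α β γ := by
  simpa only [DownUp.d, DownUp.u, map_mul, map_add, map_smul] using
    RingQuot.mkAlgHom_rel K (DownUpRel.rel1 (K := K) (α := α) (β := β) (γ := γ))

theorem DownUp.d_mul_u_sq (K : Type) [Field K] (α β γ : K) :
    DownUp.d K α β γ * DownUp.u K α β γ * DownUp.u K α β γ =
      α • (DownUp.u K α β γ * DownUp.d K α β γ * DownUp.u K α β γ) +
        β • (DownUp.u K α β γ * DownUp.u K α β γ * DownUp.d K α β γ) +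
        γ • DownUp.u K α β γ := by
  simpa only [DownUp.d, DownUp.u, map_mul, map_add, map_smul] using
    RingQuot.mkAlgHom_rel K (DownUpRel.rel2 (K := K) (α := α) (β := β) (γ := γ))

/-- Algebra maps out of a down-up algebra agree as soon as they agree on `d` and `u`. -/
theorem DownUp.algHom_ext {K : Type} [Field K] {α β γ : K} {B : Type*} [Semiring B]
    [Algebra K B] {f g : DownUp K α β γ →ₐ[K] B}
    (hd : f (DownUp.d K α β γ) = g (DownUp.d K α β γ))
    (hu : f (DownUp.u K α β γ) = g (DownUp.u K α β γ)) : f = g := by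
  refine RingQuot.ringQuot_ext' K f g (FreeAlgebra.hom_ext (funext fun i => ?_))
  fin_cases i
  · exact hd
  · exact hu

/-- A pair `x, y` in a commutative algebra with `x * y * (1 - α - β) = γ` is the image of `d, u`
under an algebra map. -/
theorem DownUp.exists_algHom {K : Type} [Field K] {α β γ : K} {B : Type*} [CommRing B]
    [Algebra K B] (x y : B) (h : (1 - α - β) • (x * y) = algebraMap K B γ) :
    ∃ f : DownUp K α β γ →ₐ[K] B, f (DownUp.d K α β γ) = x ∧ f (DownUp.u K α β γ) = y := by
  have hrel : ∀ ⦃a b⦄, DownUpRel K α β γ a b →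
      FreeAlgebra.lift K ![x, y] a = FreeAlgebra.lift K ![x, y] b := by
    rw [Algebra.smul_def, map_sub, map_sub, map_one] at h
    rintro a b (_ | _)
    · simp only [map_mul, map_add, map_smul, FreeAlgebra.lift_ι_apply, Matrix.cons_val_zero,
        Matrix.cons_val_one]
      simp only [Algebra.smul_def]
      linear_combination x * h
    · simp only [map_mul, map_add, map_smul, FreeAlgebra.lift_ι_apply, Matrix.cons_val_zero,
        Matrix.cons_val_one]
      simp only [Algebra.smul_def]
      linear_combination y * h
  refine ⟨RingQuot.liftAlgHom K ⟨FreeAlgebra.lift K ![x, y], hrel⟩, ?_, ?_⟩ <;>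
    simp [DownUp.d, DownUp.u]

theorem d_mem_downUpM0 (K : Type) [Field K] (α β γ : K) :
    DownUp.d K α β γ ∈ downUpM0 K α β γ :=
  Submodule.subset_span ⟨1, 1, Or.inl (by simp)⟩

theorem u_mem_downUpM0 (K : Type) [Field K] (α β γ : K) :
    DownUp.u K α β γ ∈ downUpM0 K α β γ :=
  Submodule.subset_span ⟨1, 1, Or.inr (by simp)⟩

theorem mul_mem_downUpM0_left {K : Type} [Field K] {α β γ : K} (c : DownUp K α β γ)
    {x : DownUp K α β γ} (hx : x ∈ downUpM0 K α β γ) : c * x ∈ downUpM0 K α β γ := by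
  induction hx using Submodule.span_induction with
  | mem x hx =>
    obtain ⟨a, b, rfl | rfl⟩ := hx
    · exact Submodule.subset_span ⟨c * a, b, Or.inl (by simp only [mul_assoc])⟩
    · exact Submodule.subset_span ⟨c * a, b, Or.inr (by simp only [mul_assoc])⟩
  | zero => simp
  | add x y _ _ hx hy => rw [mul_add]; exact add_mem hx hy
  | smul r x _ hx => rw [mul_smul_comm]; exact Submodule.smul_mem _ r hx

theorem mul_mem_downUpM0_right {K : Type} [Field K] {α β γ : K} (c : DownUp K α β γ)
    {x : DownUp K α β γ} (hx : x ∈ downUpM0 K α β γ) : x * c ∈ downUpM0 K α β γ := by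
  induction hx using Submodule.span_induction with
  | mem x hx =>
    obtain ⟨a, b, rfl | rfl⟩ := hx
    · exact Submodule.subset_span ⟨a, b * c, Or.inl (by simp only [mul_assoc])⟩
    · exact Submodule.subset_span ⟨a, b * c, Or.inr (by simp only [mul_assoc])⟩
  | zero => simp
  | add x y _ _ hx hy => rw [add_mul]; exact add_mem hx hy
  | smul r x _ hx => rw [smul_mul_assoc]; exact Submodule.smul_mem _ r hx

theorem mul_mul_mem_downUpM0_mul_self {K : Type} [Field K] {α β γ : K}
    (a b : DownUp K α β γ) {x : DownUp K α β γ}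
    (hx : x ∈ downUpM0 K α β γ * downUpM0 K α β γ) :
    a * x * b ∈ downUpM0 K α β γ * downUpM0 K α β γ := by
  induction hx using Submodule.mul_induction_on' with
  | mem_mul_mem m hm n hn =>
    have h := Submodule.mul_mem_mul (mul_mem_downUpM0_left a hm) (mul_mem_downUpM0_right b hn)
    simpa only [mul_assoc] using h
  | add x _ y _ hx hy => rw [mul_add, add_mul]; exact add_mem hx hy

theorem d_mem_downUpM0_mul_self (K : Type) [Field K] (α β γ : K) (hγ : γ ≠ 0) :
    DownUp.d K α β γ ∈ downUpM0 K α β γ * downUpM0 K α β γ := by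
  have hd := d_mem_downUpM0 K α β γ
  have hu := u_mem_downUpM0 K α β γ
  rw [← Submodule.smul_mem_iff _ hγ, eq_sub_iff_add_eq'.mpr (DownUp.d_sq_mul_u K α β γ).symm]
  exact sub_mem (Submodule.mul_mem_mul (mul_mem_downUpM0_left _ hd) hu)
    (add_mem (Submodule.smul_mem _ _ (Submodule.mul_mem_mul (mul_mem_downUpM0_left _ hu) hd))
      (Submodule.smul_mem _ _ (Submodule.mul_mem_mul (mul_mem_downUpM0_left _ hd) hd)))

theorem u_mem_downUpM0_mul_self (K : Type) [Field K] (α β γ : K) (hγ : γ ≠ 0) :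
    DownUp.u K α β γ ∈ downUpM0 K α β γ * downUpM0 K α β γ := by
  have hd := d_mem_downUpM0 K α β γ
  have hu := u_mem_downUpM0 K α β γ
  rw [← Submodule.smul_mem_iff _ hγ, eq_sub_iff_add_eq'.mpr (DownUp.d_mul_u_sq K α β γ).symm]
  exact sub_mem (Submodule.mul_mem_mul (mul_mem_downUpM0_left _ hu) hu)
    (add_mem (Submodule.smul_mem _ _ (Submodule.mul_mem_mul (mul_mem_downUpM0_left _ hd) hu))
      (Submodule.smul_mem _ _ (Submodule.mul_mem_mul (mul_mem_downUpM0_left _ hu) hd)))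

/-- If `γ ≠ 0`, then the ideal `(d, u)` is idempotent. -/
theorem downUpM0_mul_self (K : Type) [Field K] (α β γ : K) (hγ : γ ≠ 0) :
    downUpM0 K α β γ * downUpM0 K α β γ = downUpM0 K α β γ := by
  refine le_antisymm (Submodule.mul_le.mpr fun m _ n hn => mul_mem_downUpM0_left m hn)
    (Submodule.span_le.mpr ?_)
  rintro x ⟨a, b, rfl | rfl⟩
  · exact mul_mul_mem_downUpM0_mul_self a b (d_mem_downUpM0_mul_self K α β γ hγ)
  · exact mul_mul_mem_downUpM0_mul_self a b (u_mem_downUpM0_mul_self K α β γ hγ)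

/-- The kernel of a character of a down-up algebra that deforms along `d ↦ Φ d * (1 + ε)`,
`u ↦ Φ u * (1 - ε)` is not idempotent. -/
theorem ker_mul_self_ne_of_mul_eq {K : Type} [Field K] {α β γ : K} (Φ : DownUp K α β γ →ₐ[K] K)
    (hd : Φ (DownUp.d K α β γ) ≠ 0)
    (h : (1 - α - β) * (Φ (DownUp.d K α β γ) * Φ (DownUp.u K α β γ)) = γ) :
    Submodule.restrictScalars K (RingHom.ker Φ.toRingHom) *
        Submodule.restrictScalars K (RingHom.ker Φ.toRingHom) ≠
      Submodule.restrictScalars K (RingHom.ker Φ.toRingHom) := by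
  intro hidem
  set D := Φ (DownUp.d K α β γ) with hD
  set U := Φ (DownUp.u K α β γ) with hU
  obtain ⟨Ψ, hΨd, hΨu⟩ := DownUp.exists_algHom (α := α) (β := β) (γ := γ)
    (TrivSqZeroExt.inl D + TrivSqZeroExt.inr D : DualNumber K)
    (TrivSqZeroExt.inl U - TrivSqZeroExt.inr U) (by
      ext
      · simpa [TrivSqZeroExt.algebraMap_eq_inl] using h
      · simp [TrivSqZeroExt.algebraMap_eq_inl, mul_comm])
  have hfst : (TrivSqZeroExt.fstHom K K K).comp Ψ = Φ :=
    DownUp.algHom_ext (by simp [hΨd, hD]) (by simp [hΨu, hU])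
  have hker : ∀ x, x ∈ Submodule.restrictScalars K (RingHom.ker Φ.toRingHom) →
      (Ψ x).fst = 0 := fun x hx => (DFunLike.congr_fun hfst x).trans hx
  have hmul : Submodule.restrictScalars K (RingHom.ker Φ.toRingHom) *
      Submodule.restrictScalars K (RingHom.ker Φ.toRingHom) ≤ LinearMap.ker Ψ.toLinearMap :=
    Submodule.mul_le.mpr fun m hm n hn => by
      rw [LinearMap.mem_ker, AlgHom.toLinearMap_apply, map_mul]
      ext <;> simp [hker m hm, hker n hn]
  have hmem : DownUp.d K α β γ - algebraMap K _ D ∈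
      Submodule.restrictScalars K (RingHom.ker Φ.toRingHom) := by
    change Φ _ = 0
    simp [hD]
  have hzero : Ψ (DownUp.d K α β γ - algebraMap K _ D) = 0 := hmul (hidem.ge hmem)
  rw [map_sub, hΨd, AlgHom.commutes, TrivSqZeroExt.algebraMap_eq_inl] at hzero
  exact hd (by simpa using congrArg TrivSqZeroExt.snd hzero)

/-- for a type (c) down-up algebra (`β ≠ 0`, `γ ≠ 0`,
`α + β ≠ 1`), the ideal `M_μ` satisfies `M_μ² = M_μ` if and only if `μ = 0`.
Here `M₀ = (d,u)` and, for `μ ≠ 0`, `M_μ` is the kernel of the algebra map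
`Φ_μ : A → K` with `Φ_μ(d) = γ·μ⁻¹`, `Φ_μ(u) = (1−α−β)⁻¹·μ`. -/
theorem downUp_typeC_Mmu_idempotent_iff (K : Type) [Field K] [IsAlgClosed K]
    (α β γ : K) (hβ : β ≠ 0) (hγ : γ ≠ 0) (hab : α + β ≠ 1) (μ : K) :
    (μ = 0 → downUpM0 K α β γ * downUpM0 K α β γ = downUpM0 K α β γ) ∧
    (μ ≠ 0 → ∀ Φ : DownUp K α β γ →ₐ[K] K,
      Φ (DownUp.d K α β γ) = γ * μ⁻¹ → Φ (DownUp.u K α β γ) = (1 - α - β)⁻¹ * μ →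
      Submodule.restrictScalars K (RingHom.ker Φ.toRingHom) *
          Submodule.restrictScalars K (RingHom.ker Φ.toRingHom) ≠
        Submodule.restrictScalars K (RingHom.ker Φ.toRingHom)) := by
  have hne : 1 - α - β ≠ 0 := fun h => hab (by linear_combination -h)
  refine ⟨fun _ => downUpM0_mul_self K α β γ hγ, fun hμ Φ hd hu => ?_⟩
  refine ker_mul_self_ne_of_mul_eq Φ ?_ ?_
  · rw [hd]
    exact mul_ne_zero hγ (inv_ne_zero hμ)
  · rw [hd, hu]
    field_simp
end
end
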